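/- Under the RA model (W row-stochastic): for m ∈ {𝟘, 𝟙}, every δ ∈ (0,1), every t ≥ 1 with P(C_t^m(δ)) > 0 and every integer S ≥ 1, P(∩_{s=0}^S C_{t+s}^m((1−α)^s δ)) > P(C_t^m(δ)) · ∏_{s=0}^{S−1} (1 − (1−α)^s δ)^N. -/

import Mathlib

open MeasureTheory ProbabilityTheory Filter

namespace RA

variable {Ω : Type*}

/-- History σ-algebra generated by `x 1, …, x t` and `a 1, …, a (t-1)`. -/
def hist {N : ℕ} [MeasurableSpace Ω] (x a : ℕ → Ω → Fin N → ℝ) (t : ℕ) :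
    MeasurableSpace Ω :=
  (⨆ s ∈ Finset.Icc 1 t, MeasurableSpace.comap (x s) inferInstance) ⊔
  (⨆ s ∈ Finset.Ico 1 t, MeasurableSpace.comap (a s) inferInstance)

/-- The Random Actions (RA) opinion dynamics model. -/
structure IsRAModel {N : ℕ} [MeasurableSpace Ω] (μ : Measure Ω) (α : ℝ)
    (W : Matrix (Fin N) (Fin N) ℝ) (x a : ℕ → Ω → Fin N → ℝ) : Prop where
  isProb : IsProbabilityMeasure μ
  alpha_mem : α ∈ Set.Ioo (0 : ℝ) 1
  W_nonneg : ∀ i j, 0 ≤ W i j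
  W_rowsum : ∀ i, ∑ j, W i j = 1
  x_meas : ∀ t, Measurable (x t)
  a_meas : ∀ t, Measurable (a t)
  x_mem : ∀ t, 1 ≤ t → ∀ ω i, x t ω i ∈ Set.Icc (0 : ℝ) 1
  a_mem : ∀ t, 1 ≤ t → ∀ ω i, a t ω i = 0 ∨ a t ω i = 1
  update : ∀ t, 1 ≤ t → ∀ ω i,
    x (t + 1) ω i = (1 - α) * x t ω i + α * ∑ j, W i j * a t ω j
  bernoulli : ∀ t, 1 ≤ t → ∀ b : Fin N → Bool, ∀ H : Set Ω,
    MeasurableSet[hist x a t] H →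
    (μ (H ∩ {ω | ∀ i, a t ω i = if b i then (1 : ℝ) else 0})).toReal
      = ∫ ω in H, ∏ i, (if b i then x t ω i else 1 - x t ω i) ∂μ

/-- `W` is irreducible: the network is strongly connected. -/
def Irreducible {N : ℕ} (W : Matrix (Fin N) (Fin N) ℝ) : Prop :=
  ∀ i j, ∃ n : ℕ, 0 < (W ^ n) i j

/-- The event that `x t i ∈ [0,δ) ∪ (1-δ,1]`. -/
def cti {N : ℕ} (x : ℕ → Ω → Fin N → ℝ) (δ : ℝ) (t : ℕ) (i : Fin N) : Set Ω :=
  {ω | x t ω i < δ ∨ 1 - δ < x t ω i}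

def ct {N : ℕ} (x : ℕ → Ω → Fin N → ℝ) (δ : ℝ) (t : ℕ) : Set Ω :=
  ⋂ i, cti x δ t i

def c0 {N : ℕ} (x : ℕ → Ω → Fin N → ℝ) (δ : ℝ) (t : ℕ) (i : Fin N) : Set Ω :=
  {ω | x t ω i < δ}

def c1 {N : ℕ} (x : ℕ → Ω → Fin N → ℝ) (δ : ℝ) (t : ℕ) (i : Fin N) : Set Ω :=
  {ω | 1 - δ < x t ω i}

/-- The event that every coordinate of `x t` is within `δ` of `0`. -/
def corner0 {N : ℕ} (x : ℕ → Ω → Fin N → ℝ) (δ : ℝ) (t : ℕ) : Set Ω :=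
  {ω | ∀ i, x t ω i < δ}

/-- The event that every coordinate of `x t` is within `δ` of `1`. -/
def corner1 {N : ℕ} (x : ℕ → Ω → Fin N → ℝ) (δ : ℝ) (t : ℕ) : Set Ω :=
  {ω | ∀ i, 1 - δ < x t ω i}

/-- Agents `i` and `j` communicate. -/
def Communicates {N : ℕ} (W : Matrix (Fin N) (Fin N) ℝ) (i j : Fin N) : Prop :=
  (∃ n : ℕ, 0 < (W ^ n) j i) ∧ (∃ n : ℕ, 0 < (W ^ n) i j)

/-- `C` is a communication class (strongly connected component). -/
def CommClass {N : ℕ} (W : Matrix (Fin N) (Fin N) ℝ) (C : Set (Fin N)) : Prop :=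
  ∃ i, C = {j | Communicates W i j}

/-- `C` is a maximal communication class: no agent outside `C` has a directed
path into `C`. -/
def IsMaximalClass {N : ℕ} (W : Matrix (Fin N) (Fin N) ℝ) (C : Set (Fin N)) : Prop :=
  CommClass W C ∧ ∀ i ∈ C, ∀ j, (∃ n : ℕ, 0 < (W ^ n) i j) → j ∈ C

section Helpers

variable {N : ℕ} [MeasurableSpace Ω] {μ : Measure Ω} {α : ℝ} {W : Matrix (Fin N) (Fin N) ℝ}
  {x a : ℕ → Ω → Fin N → ℝ}

theorem hist_mono : Monotone (hist x a) := fun _ _ h =>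
  sup_le_sup (biSup_mono fun _ hs => Finset.Icc_subset_Icc_right h hs)
    (biSup_mono fun _ hs => Finset.Ico_subset_Ico_right h hs)

theorem measurable_hist {t : ℕ} (ht : 1 ≤ t) : Measurable[hist x a t] (x t) := by
  refine (comap_measurable (x t)).mono ?_ le_rfl
  exact le_sup_of_le_left (le_biSup (fun s => MeasurableSpace.comap (x s) inferInstance)
    (Finset.mem_Icc.2 ⟨ht, le_rfl⟩))

theorem measurableSet_hist_corner0 (δ : ℝ) {t : ℕ} (ht : 1 ≤ t) :
    MeasurableSet[hist x a t] (corner0 x δ t) := by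
  have h : MeasurableSet {v : Fin N → ℝ | ∀ i, v i < δ} := by
    simp only [Set.ofPred_forall]
    exact .iInter fun i => measurableSet_lt (measurable_pi_apply i) measurable_const
  exact measurable_hist ht h

theorem measurableSet_hist_corner1 (δ : ℝ) {t : ℕ} (ht : 1 ≤ t) :
    MeasurableSet[hist x a t] (corner1 x δ t) := by
  have h : MeasurableSet {v : Fin N → ℝ | ∀ i, 1 - δ < v i} := by
    simp only [Set.ofPred_forall]
    exact .iInter fun i => measurableSet_lt measurable_const (measurable_pi_apply i)
  exact measurable_hist ht h

theorem IsRAModel.hist_le (hRA : IsRAModel μ α W x a) (t : ℕ) :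
    hist x a t ≤ (inferInstance : MeasurableSpace Ω) :=
  sup_le (iSup₂_le fun s _ => (hRA.x_meas s).comap_le) (iSup₂_le fun s _ => (hRA.a_meas s).comap_le)

/-- If on a non-null event `H` of the past every agent plays `b` with probability more than `ε`,
then all agents play `b` simultaneously on a proportion of `H` larger than `ε ^ N`. -/
theorem IsRAModel.pow_lt_prob_unanimous (hRA : IsRAModel μ α W x a) (hN : 1 ≤ N) {t : ℕ}
    (ht : 1 ≤ t) (b : Bool) {ε : ℝ} (hε : 0 < ε) {H : Set Ω} (hH : MeasurableSet[hist x a t] H)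
    (hμ : μ H ≠ 0) (hlt : ∀ ω ∈ H, ∀ i, ε < if b then x t ω i else 1 - x t ω i) :
    (μ H).toReal * ε ^ N
      < (μ (H ∩ {ω | ∀ i, a t ω i = if b then (1 : ℝ) else 0})).toReal := by
  have := hRA.isProb
  have hHm : MeasurableSet H := hRA.hist_le t H hH
  rw [hRA.bernoulli t ht (fun _ => b) H hH]
  set f : Ω → ℝ := fun ω => ∏ i, (if b then x t ω i else 1 - x t ω i)
  have hmeas : Measurable f := by
    have hx : ∀ i, Measurable fun ω => x t ω i := fun i =>
      (measurable_pi_apply i).comp (hRA.x_meas t)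
    refine Finset.measurable_prod _ fun i _ => ?_
    cases b
    · simpa using (hx i).const_sub 1
    · simpa using hx i
  have hfactor : ∀ ω i, (if b then x t ω i else 1 - x t ω i) ∈ Set.Icc (0 : ℝ) 1 := by
    intro ω i
    have := hRA.x_mem t ht ω i
    cases b
    · simpa using this.symm
    · simpa using this
  have hint : Integrable f μ := by
    refine Integrable.of_bound hmeas.aestronglyMeasurable 1 (.of_forall fun ω => ?_)
    rw [Real.norm_of_nonneg (Finset.prod_nonneg fun i _ => (hfactor ω i).1)]
    exact Finset.prod_le_one (fun i _ => (hfactor ω i).1) fun i _ => (hfactor ω i).2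
  have hf : ∀ ω ∈ H, ε ^ N < f ω := by
    intro ω hω
    have : Nonempty (Fin N) := ⟨⟨0, hN⟩⟩
    calc ε ^ N = ∏ _i : Fin N, ε := by simp
      _ < f ω := Finset.prod_lt_prod_of_nonempty (fun _ _ => hε) (fun i _ => hlt ω hω i)
        Finset.univ_nonempty
  have hpos : 0 < ∫ ω in H, (f ω - ε ^ N) ∂μ := by
    rw [setIntegral_pos_iff_support_of_nonneg_ae]
    · have hsupp : H ⊆ Function.support fun ω => f ω - ε ^ N :=
        fun ω hω => (sub_pos.2 (hf ω hω)).ne'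
      rw [Set.inter_eq_right.2 hsupp]
      exact pos_iff_ne_zero.2 hμ
    · filter_upwards [ae_restrict_mem hHm] with ω hω using (sub_pos.2 (hf ω hω)).le
    · exact (hint.sub (integrable_const _)).integrableOn
  rw [integral_sub hint.integrableOn (integrable_const _), setIntegral_const, smul_eq_mul] at hpos
  exact sub_pos.1 hpos

theorem IsRAModel.corner0_inter_subset (hRA : IsRAModel μ α W x a) {t : ℕ} (ht : 1 ≤ t) (δ : ℝ) :
    corner0 x δ t ∩ {ω | ∀ i, a t ω i = 0} ⊆ corner0 x ((1 - α) * δ) (t + 1) := by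
  rintro ω ⟨hx, ha⟩ i
  simp only [Set.mem_ofPred_eq] at ha
  simpa [hRA.update t ht ω i, ha] using mul_lt_mul_of_pos_left (hx i) (sub_pos.2 hRA.alpha_mem.2)

theorem IsRAModel.corner1_inter_subset (hRA : IsRAModel μ α W x a) {t : ℕ} (ht : 1 ≤ t) (δ : ℝ) :
    corner1 x δ t ∩ {ω | ∀ i, a t ω i = 1} ⊆ corner1 x ((1 - α) * δ) (t + 1) := by
  rintro ω ⟨hx, ha⟩ i
  simp only [Set.mem_ofPred_eq] at ha
  have := mul_lt_mul_of_pos_left (hx i) (sub_pos.2 hRA.alpha_mem.2)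
  simp only [hRA.update t ht ω i, ha, mul_one, hRA.W_rowsum]
  linarith

/-- Iterating a strict one-step lower bound on the probability of staying in a sequence of events
adapted to a filtration. -/
theorem prob_iInter_gt_prod [IsFiniteMeasure μ] {m : ℕ → MeasurableSpace Ω} (hm : Monotone m)
    {A : ℕ → Set Ω} (hA : ∀ s, MeasurableSet[m s] (A s)) {c : ℕ → ℝ} (hc : ∀ s, 0 < c s)
    (hstep : ∀ s H, MeasurableSet[m s] H → H ⊆ A s → μ H ≠ 0 →
      (μ H).toReal * c s < (μ (H ∩ A (s + 1))).toReal)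
    (h0 : μ (A 0) ≠ 0) {S : ℕ} (hS : 1 ≤ S) :
    (μ (A 0)).toReal * ∏ s ∈ Finset.range S, c s
      < (μ (⋂ s ∈ Finset.range (S + 1), A s)).toReal := by
  have hsucc : ∀ n, ⋂ s ∈ Finset.range (n + 1), A s = (⋂ s ∈ Finset.range n, A s) ∩ A n := by
    intro n
    rw [Finset.range_add_one, Finset.set_biInter_insert, Set.inter_comm]
  have hEm : ∀ n, MeasurableSet[m n] (⋂ s ∈ Finset.range (n + 1), A s) := fun n =>
    Finset.measurableSet_biInter _ fun s hs =>
      hm (Nat.lt_succ_iff.1 (Finset.mem_range.1 hs)) _ (hA s)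
  have hpos : 0 < (μ (A 0)).toReal := ENNReal.toReal_pos h0 (measure_ne_top _ _)
  have next : ∀ n, (μ (A 0)).toReal * ∏ s ∈ Finset.range n, c s
        ≤ (μ (⋂ s ∈ Finset.range (n + 1), A s)).toReal →
      (μ (A 0)).toReal * ∏ s ∈ Finset.range (n + 1), c s
        < (μ (⋂ s ∈ Finset.range (n + 1 + 1), A s)).toReal := by
    intro n ih
    have hne : μ (⋂ s ∈ Finset.range (n + 1), A s) ≠ 0 := fun h => by
      rw [h, ENNReal.toReal_zero] at ih
      exact ih.not_gt (mul_pos hpos (Finset.prod_pos fun s _ => hc s))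
    rw [Finset.prod_range_succ, ← mul_assoc, hsucc (n + 1)]
    exact (mul_le_mul_of_nonneg_right ih (hc n).le).trans_lt
      (hstep n _ (hEm n) (Set.biInter_subset_of_mem (by simp)) hne)
  induction S, hS using Nat.le_induction with
  | base => exact next 0 (by simp)
  | succ n _ ih => exact next n ih.le

end Helpers

theorem stay_in_corner_product_bound {Ω : Type*} [MeasurableSpace Ω] {N : ℕ} (hN : 1 ≤ N)
    (μ : Measure Ω) (α : ℝ) (W : Matrix (Fin N) (Fin N) ℝ)
    (x a : ℕ → Ω → Fin N → ℝ) (hRA : IsRAModel μ α W x a) :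
    ∀ δ ∈ Set.Ioo (0 : ℝ) 1, ∀ t : ℕ, 1 ≤ t → ∀ S : ℕ, 1 ≤ S →
      (μ (corner0 x δ t) ≠ 0 →
        (μ (⋂ s ∈ Finset.range (S + 1), corner0 x ((1 - α) ^ s * δ) (t + s))).toReal
          > (μ (corner0 x δ t)).toReal
            * ∏ s ∈ Finset.range S, (1 - (1 - α) ^ s * δ) ^ N)
      ∧ (μ (corner1 x δ t) ≠ 0 →
        (μ (⋂ s ∈ Finset.range (S + 1), corner1 x ((1 - α) ^ s * δ) (t + s))).toReal
          > (μ (corner1 x δ t)).toReal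
            * ∏ s ∈ Finset.range S, (1 - (1 - α) ^ s * δ) ^ N) := by
  rintro δ ⟨hδ0, hδ1⟩ t ht S hS
  have := hRA.isProb
  have hα0 : 0 < 1 - α := sub_pos.2 hRA.alpha_mem.2
  have hα1 : 1 - α ≤ 1 := by linarith [hRA.alpha_mem.1]
  have hε : ∀ s : ℕ, 0 < 1 - (1 - α) ^ s * δ := fun s => by
    nlinarith [pow_le_one₀ (n := s) hα0.le hα1]
  have hc : ∀ s : ℕ, 0 < (1 - (1 - α) ^ s * δ) ^ N := fun s => pow_pos (hε s) N
  have hm : Monotone fun s => hist x a (t + s) := fun _ _ h => hist_mono (by omega)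
  constructor
  · intro h0
    have key := prob_iInter_gt_prod (μ := μ) hm
      (A := fun s => corner0 x ((1 - α) ^ s * δ) (t + s))
      (fun s => measurableSet_hist_corner0 _ (by omega)) hc ?_ (by simpa using h0) hS
    · simpa using key
    · intro s H hH hHA hμ
      refine (hRA.pow_lt_prob_unanimous hN (by omega) false (hε s) hH hμ
        fun ω hω i => ?_).trans_le ?_
      · simpa using hHA hω i
      · refine ENNReal.toReal_mono (measure_ne_top _ _) (measure_mono ?_)
        refine Set.subset_inter Set.inter_subset_left ?_
        rw [pow_succ', mul_assoc]
        simpa [add_assoc] using (Set.inter_subset_inter_left _ hHA).trans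
          (hRA.corner0_inter_subset (t := t + s) (by omega) ((1 - α) ^ s * δ))
  · intro h0
    have key := prob_iInter_gt_prod (μ := μ) hm
      (A := fun s => corner1 x ((1 - α) ^ s * δ) (t + s))
      (fun s => measurableSet_hist_corner1 _ (by omega)) hc ?_ (by simpa using h0) hS
    · simpa using key
    · intro s H hH hHA hμ
      refine (hRA.pow_lt_prob_unanimous hN (by omega) true (hε s) hH hμ
        fun ω hω i => ?_).trans_le ?_
      · simpa using hHA hω i
      · refine ENNReal.toReal_mono (measure_ne_top _ _) (measure_mono ?_)
        refine Set.subset_inter Set.inter_subset_left ?_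
        rw [pow_succ', mul_assoc]
        simpa [add_assoc] using (Set.inter_subset_inter_left _ hHA).trans
          (hRA.corner1_inter_subset (t := t + s) (by omega) ((1 - α) ^ s * δ))

end RA
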